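/- arXiv:1706.08326 — 2 statements merged into one kernel-verified Lean document; each statement's English description precedes it below -/
import Mathlib

section
/- Let A be a unital C*-algebra and let T : A → A be a bounded linear map which is a triple derivation at zero and satisfies T(1) = 0. Then T is a *-derivation, and hence a triple derivation. -/
/-- The C*-triple product `{a,b,c} = (1/2)(a b* c + c b* a)`. -/
noncomputable def trip {R : Type*} [NonUnitalRing R] [Module ℂ R] [Star R] (a b c : R) : R :=
  (2 : ℂ)⁻¹ • (a * star b * c + c * star b * a)

section JordanDerivation

variable {A : Type*} [CStarAlgebra A]

/-- A C*-algebra is semiprime. -/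
theorem CStarAlgebra.eq_zero_of_forall_mul_mul_self (a : A) (h : ∀ r, a * r * a = 0) : a = 0 := by
  have h2 : star (star a * a) * (star a * a) = 0 := by
    rw [star_mul, star_star, mul_assoc, ← mul_assoc a, h, mul_zero]
  exact CStarRing.star_mul_self_eq_zero_iff a |>.1
    (CStarRing.star_mul_self_eq_zero_iff (star a * a) |>.1 h2)

theorem CStarAlgebra.eq_zero_of_eq_neg {a : A} (h : a = -a) : a = 0 := by
  have h2 : (2 : ℂ) • a = 0 := by
    rw [two_smul]
    nth_rewrite 1 [h]
    simp
  simpa using h2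

theorem CStarAlgebra.mul_mul_eq_zero_of_anticommute (a b : A)
    (h : ∀ r, a * r * b + b * r * a = 0) (r : A) : a * r * b = 0 := by
  have h' : ∀ r, a * r * b = -(b * r * a) := fun r => eq_neg_of_add_eq_zero_left (h r)
  refine CStarAlgebra.eq_zero_of_forall_mul_mul_self _ fun s =>
    CStarAlgebra.eq_zero_of_eq_neg ?_
  calc a * r * b * s * (a * r * b)
      = a * r * (b * s * a) * r * b := by noncomm_ring
    _ = -(a * r * (a * s * b) * r * b) := by rw [h' s]; noncomm_ring
    _ = -((a * (r * a * s) * b) * r * b) := by noncomm_ring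
    _ = (b * r * a) * s * (a * r * b) := by rw [h' (r * a * s)]; noncomm_ring
    _ = -(a * r * b * s * (a * r * b)) := by rw [h' r]; noncomm_ring

/-- The defect of the Leibniz rule for `D`, as a bilinear map. -/
noncomputable def leibnizDefect (D : A →ₗ[ℂ] A) : A →ₗ[ℂ] A →ₗ[ℂ] A :=
  LinearMap.mk₂ ℂ (fun x y => D (x * y) - D x * y - x * D y)
    (by intros; simp only [add_mul, map_add]; abel)
    (by intros; simp only [smul_mul_assoc, map_smul, smul_sub])
    (by intros; simp only [mul_add, map_add]; abel)
    (by intros; simp only [mul_smul_comm, map_smul, smul_sub])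

theorem leibnizDefect_apply (D : A →ₗ[ℂ] A) (x y : A) :
    leibnizDefect D x y = D (x * y) - D x * y - x * D y := rfl

variable {D : A →ₗ[ℂ] A}

theorem map_mul_add_mul_of_jordan (hD : ∀ x, D (x * x) = D x * x + x * D x) (x y : A) :
    D (x * y + y * x) = D x * y + x * D y + D y * x + y * D x := by
  have h := hD (x + y)
  simp only [add_mul, mul_add, map_add, hD] at h ⊢
  rw [← sub_eq_zero] at h ⊢
  rw [← h]
  abel

theorem map_mul_mul_self_of_jordan (hD : ∀ x, D (x * x) = D x * x + x * D x) (x y : A) :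
    D (x * y * x) = D x * y * x + x * D y * x + x * y * D x := by
  have h1 := map_mul_add_mul_of_jordan hD x (x * y + y * x)
  rw [map_mul_add_mul_of_jordan hD x y] at h1
  have h2 := map_mul_add_mul_of_jordan hD (x * x) y
  rw [hD] at h2
  have h3 : x * (x * y + y * x) + (x * y + y * x) * x =
      (x * x * y + y * (x * x)) + (x * y * x + x * y * x) := by noncomm_ring
  rw [h3, map_add, h2, map_add] at h1
  refine sub_eq_zero.1 (CStarAlgebra.eq_zero_of_eq_neg ?_)
  rw [eq_neg_iff_add_eq_zero]
  rw [← sub_eq_zero] at h1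
  rw [← h1]
  noncomm_ring

theorem map_mul_mul_add_of_jordan (hD : ∀ x, D (x * x) = D x * x + x * D x) (x y z : A) :
    D (x * y * z) + D (z * y * x) = D x * y * z + x * D y * z + x * y * D z +
      (D z * y * x + z * D y * x + z * y * D x) := by
  have h := map_mul_mul_self_of_jordan hD (x + z) y
  simp only [add_mul, mul_add, map_add, map_mul_mul_self_of_jordan hD] at h
  rw [← sub_eq_zero] at h ⊢
  rw [← h]
  abel

theorem leibnizDefect_anticommute (hD : ∀ x, D (x * x) = D x * x + x * D x) (a b r : A) :
    leibnizDefect D a b * r * (a * b - b * a) +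
      (a * b - b * a) * r * leibnizDefect D a b = 0 := by
  have hab : D (a * b) = leibnizDefect D a b + D a * b + a * D b := by
    rw [leibnizDefect_apply]; abel
  have hba : D (b * a) = -leibnizDefect D a b + D b * a + b * D a := by
    have h := map_mul_add_mul_of_jordan hD a b
    rw [map_add, hab] at h
    rw [← sub_eq_zero] at h ⊢
    rw [← h]
    abel
  have h1 := map_mul_mul_add_of_jordan hD (a * b) r (b * a)
  rw [hab, hba] at h1
  have e1 : a * b * r * (b * a) = a * (b * r * b) * a := by noncomm_ring
  have e2 : b * a * r * (a * b) = b * (a * r * a) * b := by noncomm_ring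
  rw [e1, e2] at h1
  simp only [map_mul_mul_self_of_jordan hD] at h1
  rw [← sub_eq_zero] at h1
  rw [← h1]
  noncomm_ring

theorem leibnizDefect_mul_mul_commutator (hD : ∀ x, D (x * x) = D x * x + x * D x)
    (a b c d r : A) : leibnizDefect D a b * r * (c * d - d * c) = 0 := by
  have h0 : ∀ a b r, leibnizDefect D a b * r * (a * b - b * a) = 0 := fun a b r =>
    CStarAlgebra.mul_mul_eq_zero_of_anticommute _ _ (leibnizDefect_anticommute hD a b) r
  have h1 : ∀ a b c r, leibnizDefect D a b * r * (c * b - b * c) = 0 := by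
    intro a b c r
    have h : ∀ r, leibnizDefect D a b * r * (c * b - b * c) =
        -(leibnizDefect D c b * r * (a * b - b * a)) := by
      intro r
      have h := h0 (a + c) b r
      rw [map_add, LinearMap.add_apply] at h
      rw [eq_neg_iff_add_eq_zero, ← h, ← sub_eq_zero]
      have ha := h0 a b r
      have hc := h0 c b r
      calc _ = -(leibnizDefect D a b * r * (a * b - b * a)) -
            leibnizDefect D c b * r * (c * b - b * c) := by noncomm_ring
        _ = 0 := by rw [ha, hc]; simp
    refine CStarAlgebra.eq_zero_of_forall_mul_mul_self _ fun s => ?_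
    calc _ = leibnizDefect D a b * r * (c * b - b * c) * s *
          -(leibnizDefect D c b * r * (a * b - b * a)) := by rw [← h r]
      _ = -(leibnizDefect D a b * (r * (c * b - b * c) * s * leibnizDefect D c b * r) *
          (a * b - b * a)) := by noncomm_ring
      _ = 0 := by rw [h0, neg_zero]
  have h : ∀ r, leibnizDefect D a b * r * (c * d - d * c) =
      -(leibnizDefect D a d * r * (c * b - b * c)) := by
    intro r
    have h := h1 a (b + d) c r
    rw [map_add] at h
    rw [eq_neg_iff_add_eq_zero, ← h, ← sub_eq_zero]
    have hb := h1 a b c r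
    have hd := h1 a d c r
    calc _ = -(leibnizDefect D a b * r * (c * b - b * c)) -
          leibnizDefect D a d * r * (c * d - d * c) := by noncomm_ring
      _ = 0 := by rw [hb, hd]; simp
  refine CStarAlgebra.eq_zero_of_forall_mul_mul_self _ fun s => ?_
  calc _ = leibnizDefect D a b * r * (c * d - d * c) * s *
        -(leibnizDefect D a d * r * (c * b - b * c)) := by rw [← h r]
    _ = -(leibnizDefect D a b * (r * (c * d - d * c) * s * leibnizDefect D a d * r) *
        (c * b - b * c)) := by noncomm_ring
    _ = 0 := by rw [h1, neg_zero]

/-- A central element of a C*-algebra with square zero vanishes. -/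
theorem CStarAlgebra.eq_zero_of_central_of_mul_self {z : A} (hz : ∀ c, z * c = c * z)
    (h : z * z = 0) : z = 0 :=
  CStarAlgebra.eq_zero_of_forall_mul_mul_self z fun r => by rw [hz, mul_assoc, h, mul_zero]

/-- A Jordan derivation on a C*-algebra is a derivation. -/
theorem map_mul_of_jordan (hD : ∀ x, D (x * x) = D x * x + x * D x) (a b : A) :
    D (a * b) = D a * b + a * D b := by
  set δ := leibnizDefect D a b with hδ
  have hcomm : ∀ r c d, δ * r * (c * d - d * c) = 0 := fun r c d =>
    leibnizDefect_mul_mul_commutator hD a b c d r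
  have hcent : ∀ c, δ * c = c * δ := by
    intro c
    refine sub_eq_zero.1 (CStarAlgebra.eq_zero_of_forall_mul_mul_self _ fun r => ?_)
    calc _ = δ * (c * r) * (δ * c - c * δ) - c * (δ * r * (δ * c - c * δ)) := by noncomm_ring
      _ = 0 := by rw [hcomm, hcomm]; simp
  have hδ2 : δ * (D (a * b - b * a)) = δ * (δ + δ) := by
    have h := map_mul_add_mul_of_jordan hD a b
    have hab : D (a * b) = δ + D a * b + a * D b := by
      rw [hδ, leibnizDefect_apply]; abel
    have hba : D (b * a) = -δ + D b * a + b * D a := by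
      rw [map_add, hab] at h
      rw [← sub_eq_zero] at h ⊢
      rw [← h]
      abel
    rw [map_sub, hab, hba]
    have e1 := hcomm 1 (D a) b
    have e2 := hcomm 1 a (D b)
    calc _ = δ * (δ + δ) + δ * 1 * (D a * b - b * D a) + δ * 1 * (a * D b - D b * a) := by
          noncomm_ring
      _ = _ := by rw [e1, e2]; simp
  have h0 : δ * (a * b - b * a) = 0 := by simpa using hcomm 1 a b
  have hJ := map_mul_add_mul_of_jordan hD δ (a * b - b * a)
  rw [← hcent (a * b - b * a), h0, add_zero, map_zero] at hJ
  have hcube : (δ * δ * δ) = 0 := by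
    have h4 : δ * δ * (δ + δ) + δ * δ * (δ + δ) = 0 := by
      calc _ = δ * (δ * D (a * b - b * a)) + δ * (δ * D (a * b - b * a)) := by
            rw [hδ2]; noncomm_ring
        _ = δ * (D δ * (a * b - b * a) + δ * D (a * b - b * a) +
            D (a * b - b * a) * δ + (a * b - b * a) * D δ) := by
            rw [← hcent (D (a * b - b * a))]
            have e1 := hcomm (D δ) a b
            calc _ = δ * (δ * D (a * b - b * a)) + δ * (δ * D (a * b - b * a)) +
                  δ * D δ * (a * b - b * a) + δ * (a * b - b * a) * D δ := by
                    rw [e1, h0]; simp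
              _ = _ := by noncomm_ring
        _ = 0 := by rw [← hJ, mul_zero]
    have h5 : (4 : ℂ) • (δ * δ * δ) = 0 := by
      rw [← h4, show (4 : ℂ) = 1 + 1 + 1 + 1 by norm_num]
      simp only [add_smul, one_smul, mul_add]
      abel
    simpa using h5
  have hsq : δ * δ = 0 := by
    refine CStarAlgebra.eq_zero_of_central_of_mul_self (fun c => ?_) ?_
    · rw [mul_assoc, hcent c, ← mul_assoc, hcent c, mul_assoc]
    · rw [← mul_assoc, hcube, zero_mul]
  have hzero := CStarAlgebra.eq_zero_of_central_of_mul_self hcent hsq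
  rw [hδ, leibnizDefect_apply, sub_sub, sub_eq_zero] at hzero
  exact hzero

end JordanDerivation

section ZeroProduct

variable {A : Type*} [CStarAlgebra A]

/-- A complex bilinear map vanishing on the diagonal at selfadjoint elements is alternating. -/
theorem apply_self_eq_zero_of_selfAdjoint (W : A →ₗ[ℂ] A →ₗ[ℂ] A)
    (h : ∀ a, IsSelfAdjoint a → W a a = 0) (x : A) : W x x = 0 := by
  set a : A := (realPart x : A)
  set b : A := (imaginaryPart x : A)
  have hsa : IsSelfAdjoint a := (realPart x).2
  have hsb : IsSelfAdjoint b := (imaginaryPart x).2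
  have hab := h (a + b) (hsa.add hsb)
  have hx : x = a + Complex.I • b := (realPart_add_I_smul_imaginaryPart x).symm
  simp only [map_add, LinearMap.add_apply, h a hsa, h b hsb, zero_add, add_zero] at hab
  rw [hx]
  simp only [map_add, LinearMap.add_apply, map_smul, LinearMap.smul_apply, h a hsa, h b hsb,
    smul_zero, zero_add, add_zero]
  rw [← smul_add, hab, smul_zero]

/-- A bounded symmetric bilinear map vanishing on selfadjoint pairs with zero product
depends, on the diagonal, only on the square. -/
theorem apply_self_eq_apply_mul_self_one (V : A →ₗ[ℂ] A →ₗ[ℂ] A) (C : ℝ)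
    (hC : ∀ x y, ‖V x y‖ ≤ C * ‖x‖ * ‖y‖) (hsymm : ∀ x y, V x y = V y x)
    (hzero : ∀ x y, IsSelfAdjoint x → IsSelfAdjoint y → x * y = 0 → V x y = 0)
    (h : A) (hh : IsSelfAdjoint h) : V h h = V (h * h) 1 := by
  rcases subsingleton_or_nontrivial A with hA | hA
  · exact Subsingleton.elim _ _
  let F : ℝ → A := fun t => cfc (fun x : ℝ => max (x - t) 0) h
  let E : ℝ → A := fun t => V (F t) (F t) - V (F t * F t) 1
  have hC0 : 0 ≤ C := by
    have := (norm_nonneg _).trans (hC 1 1)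
    simpa using this
  have key : ∀ s t, s ≤ t → ‖E s - E t‖ ≤ 2 * C * (t - s) ^ 2 := by
    intro s t hst
    set c : A := cfc (fun x : ℝ => max (x - s) 0 - max (x - t) 0) h with hc
    have hFs : F s = c + F t := by
      rw [hc, cfc_sub (fun x : ℝ => max (x - s) 0) (fun x : ℝ => max (x - t) 0) h]
      simp [F]
    have hcF : c * F t = (t - s) • F t := by
      simp only [hc, F]
      rw [← cfc_mul _ _ h, ← cfc_smul _ _ h]
      congr 1
      funext x
      rcases le_total x t with hx | hx
      · simp [max_eq_right (sub_nonpos.2 hx)]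
      · rw [max_eq_left (sub_nonneg.2 hx), max_eq_left (by linarith)]
        simp only [smul_eq_mul]; ring
    have hFc : F t * c = (t - s) • F t := by
      rw [← hcF]
      exact (cfc_commute_cfc _ _ h)
    have hcsa : IsSelfAdjoint c := cfc_predicate _ h
    have hFsa : IsSelfAdjoint (F t) := cfc_predicate _ h
    have hVcF : V c (F t) = ((t - s : ℝ) : ℂ) • V 1 (F t) := by
      have h0 : V (c - (t - s) • (1 : A)) (F t) = 0 := by
        refine hzero _ _ (hcsa.sub ((IsSelfAdjoint.all (t - s)).smul (IsSelfAdjoint.one A))) hFsa ?_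
        rw [sub_mul, hcF, smul_mul_assoc, one_mul, sub_self]
      rw [← Complex.coe_smul, map_sub, map_smul, LinearMap.sub_apply, LinearMap.smul_apply,
        sub_eq_zero] at h0
      exact h0
    have hE : E s - E t = V c c - V (c * c) 1 := by
      simp only [E, hFs, add_mul, mul_add, hcF, hFc, map_add, LinearMap.add_apply,
        hsymm (F t) c, hVcF]
      rw [← Complex.coe_smul, map_smul, LinearMap.smul_apply, hsymm (F t) 1]
      abel
    have hcn : ‖c‖ ≤ t - s := by
      refine norm_cfc_le (by linarith) fun x _ => ?_
      rw [Real.norm_eq_abs, abs_le]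
      rcases le_total x t with hx | hx <;> rcases le_total x s with hx' | hx' <;>
      constructor <;> simp only [max_def] <;> split_ifs <;> linarith
    rw [hE]
    have hcc : ‖c * c‖ ≤ (t - s) ^ 2 := by
      rw [sq]
      exact (norm_mul_le _ _).trans (by gcongr)
    calc _ ≤ ‖V c c‖ + ‖V (c * c) 1‖ := norm_sub_le _ _
      _ ≤ C * ‖c‖ * ‖c‖ + C * ‖c * c‖ * ‖(1 : A)‖ := add_le_add (hC _ _) (hC _ _)
      _ ≤ C * (t - s) * (t - s) + C * (t - s) ^ 2 * 1 := by
        rw [CStarRing.norm_one]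
        have : 0 ≤ t - s := by linarith
        gcongr
      _ = _ := by ring
  have key' : ∀ s t, ‖E s - E t‖ ≤ 2 * C * ‖s - t‖ ^ 2 := by
    intro s t
    rw [Real.norm_eq_abs, sq_abs]
    rcases le_total s t with hst | hst
    · exact (key s t hst).trans_eq (by ring)
    · rw [norm_sub_rev]; exact key t s hst
  have hderiv : ∀ t, HasDerivAt E 0 t := by
    intro t
    rw [hasDerivAt_iff_isLittleO]
    simp only [smul_zero, sub_zero]
    refine Asymptotics.IsBigO.trans_isLittleO (g := fun s => ‖s - t‖ ^ 2)
      (Asymptotics.IsBigO.of_bound (2 * C) (Filter.Eventually.of_forall fun s => ?_)) ?_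
    · simpa using key' s t
    · have := Asymptotics.isLittleO_pow_sub_sub t (m := 2) (by norm_num)
      simpa using this
  have hconst := is_const_of_deriv_eq_zero (fun t => (hderiv t).differentiableAt)
    (fun t => (hderiv t).deriv) (-‖h‖) ‖h‖
  have hsp : ∀ x ∈ spectrum ℝ h, |x| ≤ ‖h‖ := fun x hx => spectrum.norm_le_norm_of_mem hx
  have hF1 : F ‖h‖ = 0 := by
    have : F ‖h‖ = cfc (fun _ : ℝ => (0 : ℝ)) h := cfc_congr fun x hx =>
      max_eq_right (by linarith [(abs_le.1 (hsp x hx)).2])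
    rw [this, cfc_const_zero]
  have hF2 : F (-‖h‖) = h + (‖h‖ : ℂ) • (1 : A) := by
    have : F (-‖h‖) = cfc (fun x : ℝ => x + ‖h‖) h := cfc_congr fun x hx => by
      simp only [sub_neg_eq_add]
      exact max_eq_left (by linarith [(abs_le.1 (hsp x hx)).1])
    rw [this, cfc_add_const _ _ h, cfc_id' ℝ h, Algebra.algebraMap_eq_smul_one, Complex.coe_smul]
  simp only [E, hF1, hF2] at hconst
  simp only [map_zero, mul_zero, LinearMap.zero_apply, sub_zero, add_mul, mul_add, map_add,
    LinearMap.add_apply, map_smul, LinearMap.smul_apply, smul_mul_assoc, mul_smul_comm, one_mul,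
    mul_one, hsymm 1 h] at hconst
  rw [← sub_eq_zero, ← hconst]
  abel

end ZeroProduct

section Derivation

variable {A : Type*} [CStarAlgebra A]

/-- A bounded derivation which sends every element into its commutant vanishes. -/
theorem derivation_eq_zero_of_commute (R : A →ₗ[ℂ] A) (C : ℝ) (hC : ∀ x, ‖R x‖ ≤ C * ‖x‖)
    (hR : ∀ x y, R (x * y) = R x * y + x * R y) (hcomm : ∀ x, R x * x = x * R x) : R = 0 := by
  rcases subsingleton_or_nontrivial A with hA | hA
  · exact LinearMap.ext fun x => Subsingleton.elim _ _
  have hu : ∀ u ∈ unitary A, R u = 0 := by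
    intro u hu
    have hpow : ∀ n : ℕ, R (u ^ (n + 1)) = (n + 1 : ℂ) • (u ^ n * R u) := by
      intro n
      induction n with
      | zero => simp
      | succ n ih =>
        rw [pow_succ, hR, ih, smul_mul_assoc, mul_assoc, hcomm u, ← mul_assoc, ← pow_succ]
        push_cast
        rw [add_smul ((n : ℂ) + 1) 1, one_smul]
    have hnorm : ∀ n : ℕ, (n + 1 : ℝ) * ‖R u‖ ≤ C := by
      intro n
      have h := hC (u ^ (n + 1))
      rw [hpow, norm_smul, CStarRing.norm_mem_unitary_mul _ (pow_mem hu n),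
        CStarRing.norm_of_mem_unitary (pow_mem hu (n + 1)), mul_one] at h
      convert h using 2
      rw [show (n + 1 : ℂ) = ((n + 1 : ℕ) : ℂ) by push_cast; rfl, Complex.norm_natCast]
      push_cast
      rfl
    by_contra hne
    have hpos : 0 < ‖R u‖ := norm_pos_iff.2 hne
    obtain ⟨n, hn⟩ := exists_nat_gt (C / ‖R u‖)
    rw [div_lt_iff₀ hpos] at hn
    linarith [hnorm n]
  refine LinearMap.ext_on (CStarAlgebra.span_unitary A) fun u hu' => ?_
  simpa using hu u hu'

/-- The conjugate `x ↦ (T x*)*` of a linear map. -/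
noncomputable def starConjugate (T : A →ₗ[ℂ] A) : A →ₗ[ℂ] A where
  toFun x := star (T (star x))
  map_add' := by simp
  map_smul' := by simp

variable {T : A →ₗ[ℂ] A}

theorem trip_eq_zero_iff (a b c : A) :
    trip a b c = 0 ↔ a * star b * c + c * star b * a = 0 := by
  simp only [trip, smul_eq_zero, inv_eq_zero, OfNat.ofNat_ne_zero, false_or]

theorem tripleDerivationAtZero_expand
    (hT : ∀ a b c : A, trip a b c = 0 →
      trip (T a) b c + trip a (T b) c + trip a b (T c) = 0)
    (a b c : A) (h : a * star b * c + c * star b * a = 0) :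
    (T a * star b * c + c * star b * T a) + (a * star (T b) * c + c * star (T b) * a) +
      (a * star b * T c + T c * star b * a) = 0 := by
  have := hT a b c ((trip_eq_zero_iff a b c).2 h)
  simpa only [trip, ← smul_add, smul_eq_zero, inv_eq_zero, OfNat.ofNat_ne_zero, false_or]
    using this

theorem mul_comm_zero_of_selfAdjoint {x y : A} (hx : IsSelfAdjoint x) (hy : IsSelfAdjoint y)
    (h : x * y = 0) : y * x = 0 := by
  have := congrArg star h
  simpa [hx.star_eq, hy.star_eq] using this

theorem tripleDerivationAtZero_jordan (C : ℝ) (hC0 : ∀ x, ‖T x‖ ≤ C * ‖x‖)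
    (hT : ∀ a b c : A, trip a b c = 0 →
      trip (T a) b c + trip a (T b) c + trip a b (T c) = 0)
    (h1 : T 1 = 0) (x : A) : T (x * x) = T x * x + x * T x := by
  let V : A →ₗ[ℂ] A →ₗ[ℂ] A := LinearMap.mk₂ ℂ
    (fun x y => T x * y + y * T x + x * T y + T y * x)
    (by intros; simp only [add_mul, mul_add, map_add]; abel)
    (by intros; simp only [smul_mul_assoc, mul_smul_comm, map_smul, smul_add])
    (by intros; simp only [add_mul, mul_add, map_add]; abel)
    (by intros; simp only [smul_mul_assoc, mul_smul_comm, map_smul, smul_add])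
  have hV : ∀ x y, V x y = T x * y + y * T x + x * T y + T y * x := fun _ _ => rfl
  have hsa : ∀ a, IsSelfAdjoint a → leibnizDefect T a a = 0 := by
    intro a ha
    have h := apply_self_eq_apply_mul_self_one V (4 * C) ?_ ?_ ?_ a ha
    · rw [hV, hV, h1] at h
      simp only [mul_one, one_mul, mul_zero, zero_mul, add_zero] at h
      rw [leibnizDefect_apply]
      refine CStarAlgebra.eq_zero_of_eq_neg ?_
      rw [eq_neg_iff_add_eq_zero]
      rw [← sub_eq_zero] at h
      rw [← neg_eq_zero, ← h]
      abel
    · intro x y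
      have e : ∀ x y, ‖T x * y‖ ≤ C * ‖x‖ * ‖y‖ := fun x y =>
        (norm_mul_le _ _).trans (by gcongr; exact hC0 x)
      have e' : ∀ x y, ‖y * T x‖ ≤ C * ‖x‖ * ‖y‖ := fun x y =>
        (norm_mul_le _ _).trans (by rw [mul_comm]; gcongr; exact hC0 x)
      rw [hV]
      refine (norm_add₄_le).trans ?_
      linarith [e x y, e' x y, e y x, e' y x]
    · intro x y
      rw [hV, hV]
      abel
    · intro x y hx hy hxy
      have h := tripleDerivationAtZero_expand hT x 1 y
        (by simp [hxy, mul_comm_zero_of_selfAdjoint hx hy hxy])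
      simp only [h1, star_zero, star_one, mul_one, mul_zero, zero_mul, add_zero] at h
      rw [hV, ← h]
      abel
  have := apply_self_eq_zero_of_selfAdjoint _ hsa x
  rw [leibnizDefect_apply, sub_sub, sub_eq_zero] at this
  exact this

theorem tripleDerivationAtZero_star (C : ℝ) (hC : ∀ x, ‖T x‖ ≤ C * ‖x‖)
    (hT : ∀ a b c : A, trip a b c = 0 →
      trip (T a) b c + trip a (T b) c + trip a b (T c) = 0)
    (hmul : ∀ x y, T (x * y) = T x * y + x * T y) (x : A) : T (star x) = star (T x) := by
  set R : A →ₗ[ℂ] A := T - starConjugate T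
  have hRapp : ∀ x, R x = T x - star (T (star x)) := fun _ => rfl
  have hR : ∀ x y, R (x * y) = R x * y + x * R y := by
    intro x y
    simp only [hRapp, star_mul, hmul, star_add, star_star]
    noncomm_ring
  have hR1 : R 1 = 0 := by simpa using hR 1 1
  have hRC : ∀ x, ‖R x‖ ≤ (2 * C) * ‖x‖ := by
    intro x
    have h2 := hC (star x)
    rw [norm_star] at h2
    rw [hRapp]
    refine (norm_sub_le _ _).trans ?_
    rw [norm_star]
    linarith [hC x]
  have hzero : ∀ x y, IsSelfAdjoint x → IsSelfAdjoint y → x * y = 0 → x * R y = 0 := by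
    intro x y hx hy hxy
    have hyx := mul_comm_zero_of_selfAdjoint hx hy hxy
    have hall : ∀ c, x * R y * c + c * (R y * x) = 0 := by
      intro c
      have h := tripleDerivationAtZero_expand hT x y c (by
        rw [hy.star_eq, hxy, mul_assoc, hyx]; simp)
      have e1 : T x * y = -(x * T y) := by
        rw [eq_neg_iff_add_eq_zero, ← hmul, hxy, map_zero]
      have e2 : y * T x = -(T y * x) := by
        rw [eq_neg_iff_add_eq_zero, add_comm, ← hmul, hyx, map_zero]
      rw [hy.star_eq, hxy, mul_assoc c y, mul_assoc (T c), hyx, e1, e2] at h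
      rw [hRapp, hy.star_eq, ← neg_eq_zero, ← h]
      noncomm_ring
    have hanti : R y * x = -(x * R y) := by
      rw [eq_neg_iff_add_eq_zero, add_comm]
      simpa using hall 1
    have hcent : ∀ c, x * R y * c = c * (x * R y) := by
      intro c
      have h := hall c
      rw [hanti, mul_neg, ← sub_eq_add_neg, sub_eq_zero] at h
      exact h
    set z := x * R y with hz
    clear_value z
    have hRz : ∀ c, R z * c = c * R z := by
      intro c
      have h := congrArg R (hcent c)
      rw [hR, hR, hcent, add_comm (R c * z)] at h
      exact add_right_cancel h
    have hzy : z * y = 0 := by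
      rw [← neg_eq_zero, ← neg_mul, ← hanti, mul_assoc, hxy, mul_zero]
    have hRzy : z * R y = -(R z * y) := by
      rw [eq_neg_iff_add_eq_zero, add_comm, ← hR, hzy, map_zero]
    refine CStarAlgebra.eq_zero_of_central_of_mul_self hcent ?_
    calc z * z = z * x * R y := by rw [mul_assoc, ← hz]
      _ = x * (z * R y) := by rw [hcent, mul_assoc]
      _ = -(R z * (x * y)) := by rw [hRzy, mul_neg, ← mul_assoc, ← hRz, mul_assoc]
      _ = 0 := by rw [hxy, mul_zero, neg_zero]
  let V : A →ₗ[ℂ] A →ₗ[ℂ] A := LinearMap.mk₂ ℂ (fun x y => x * R y + y * R x)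
    (by intros; simp only [add_mul, mul_add, map_add]; abel)
    (by intros; simp only [smul_mul_assoc, mul_smul_comm, map_smul, smul_add])
    (by intros; simp only [add_mul, mul_add, map_add]; abel)
    (by intros; simp only [smul_mul_assoc, mul_smul_comm, map_smul, smul_add])
  have hV : ∀ x y, V x y = x * R y + y * R x := fun _ _ => rfl
  let W : A →ₗ[ℂ] A →ₗ[ℂ] A := LinearMap.mk₂ ℂ (fun x y => R x * y - y * R x)
    (by intros; simp only [add_mul, mul_add, map_add]; abel)
    (by intros; simp only [smul_mul_assoc, mul_smul_comm, map_smul, smul_sub])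
    (by intros; simp only [add_mul, mul_add]; abel)
    (by intros; simp only [smul_mul_assoc, mul_smul_comm, smul_sub])
  have hW : ∀ x y, W x y = R x * y - y * R x := fun _ _ => rfl
  have hWsa : ∀ a, IsSelfAdjoint a → W a a = 0 := by
    intro a ha
    have h := apply_self_eq_apply_mul_self_one V (2 * (2 * C)) ?_ ?_ ?_ a ha
    · rw [hV, hV, hR1, hR, mul_zero, zero_add, one_mul] at h
      rw [hW, sub_eq_zero]
      exact (add_right_cancel h).symm
    · intro x y
      have e : ∀ x y, ‖y * R x‖ ≤ (2 * C) * ‖x‖ * ‖y‖ := fun x y =>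
        (norm_mul_le _ _).trans (by rw [mul_comm]; gcongr; exact hRC x)
      rw [hV]
      refine (norm_add_le _ _).trans ?_
      linarith [e x y, e y x]
    · intro x y
      rw [hV, hV, add_comm]
    · intro x y hx hy hxy
      rw [hV, hzero x y hx hy hxy, hzero y x hy hx (mul_comm_zero_of_selfAdjoint hx hy hxy),
        add_zero]
  have hRzero := derivation_eq_zero_of_commute R (2 * C) hRC hR fun x => by
    rw [← sub_eq_zero, ← hW]
    exact apply_self_eq_zero_of_selfAdjoint W hWsa x
  have h := hRapp (star x)
  rw [hRzero, LinearMap.zero_apply, star_star] at h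
  exact (sub_eq_zero.1 h.symm)

end Derivation

/-- A bounded linear map `T` on a unital C*-algebra which is a triple derivation at zero and
satisfies `T(1) = 0` is a `*`-derivation, and hence a triple derivation. -/
theorem stmt9 {A : Type*} [CStarAlgebra A] (T : A →ₗ[ℂ] A) (hcont : Continuous T)
    (hT : ∀ a b c : A, trip a b c = 0 →
      trip (T a) b c + trip a (T b) c + trip a b (T c) = 0)
    (h1 : T 1 = 0) :
    (∀ x y : A, T (x * y) = T x * y + x * T y) ∧
    (∀ x : A, T (star x) = star (T x)) ∧
    (∀ a b c : A, T (trip a b c) = trip (T a) b c + trip a (T b) c + trip a b (T c)) := by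
  have hC : ∀ x, ‖T x‖ ≤ ‖(⟨T, hcont⟩ : A →L[ℂ] A)‖ * ‖x‖ := fun x =>
    ContinuousLinearMap.le_opNorm (⟨T, hcont⟩ : A →L[ℂ] A) x
  have hmul := map_mul_of_jordan (tripleDerivationAtZero_jordan _ hC hT h1)
  have hstar := tripleDerivationAtZero_star _ hC hT hmul
  refine ⟨hmul, hstar, fun a b c => ?_⟩
  simp only [trip, map_smul, map_add, hmul, hstar, ← smul_add]
  congr 1
  noncomm_ring
end

section
/- Every generalized derivation on a von Neumann algebra is continuous: if M is a von Neumann algebra and T : M → M is a linear map satisfying T(xy) = T(x)y + xT(y) − xT(1)y for all x, y ∈ M, then T is continuous. -/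
open Filter Topology
open scoped ComplexStarModule

/-- An everywhere defined dissipative operator on a real Banach space is continuous. -/
theorem LinearMap.continuous_of_norm_le_norm_add_smul {E : Type*} [NormedAddCommGroup E]
    [NormedSpace ℝ E] [CompleteSpace E] (L : E →ₗ[ℝ] E)
    (hL : ∀ (t : ℝ) (x : E), ‖x‖ ≤ ‖x + t • L x‖) : Continuous L := by
  refine L.continuous_of_seq_closed_graph fun u x y hu hLu ↦ ?_
  set w := y - L x with hw
  have hv : Tendsto (fun n ↦ u n - x) atTop (𝓝 0) := by
    simpa using hu.sub_const x
  have hLv : Tendsto (fun n ↦ L (u n - x)) atTop (𝓝 w) := by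
    simpa [hw] using hLu.sub_const (L x)
  have scaled (a : E) (t : ℝ) (ht : 0 < t) : ‖a‖ ≤ ‖a + w + t • L a‖ := by
    have h1 : Tendsto (fun n ↦ ‖t⁻¹ • (u n - x) + a‖) atTop (𝓝 ‖t⁻¹ • (0 : E) + a‖) :=
      ((hv.const_smul t⁻¹).add_const a).norm
    have h2 : Tendsto (fun n ↦ ‖t⁻¹ • (u n - x) + a + (L (u n - x) + t • L a)‖) atTop
        (𝓝 ‖t⁻¹ • (0 : E) + a + (w + t • L a)‖) :=
      (((hv.const_smul t⁻¹).add_const a).add (hLv.add_const _)).norm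
    have h3 := le_of_tendsto_of_tendsto' h1 h2 fun n ↦ by
      have := hL t (t⁻¹ • (u n - x) + a)
      rwa [map_add, map_smul, smul_add, smul_inv_smul₀ ht.ne'] at this
    simpa [add_assoc] using h3
  have key (a : E) : ‖a‖ ≤ ‖a + w‖ := by
    have h : Tendsto (fun t : ℝ ↦ ‖a + w + t • L a‖) (𝓝[>] 0) (𝓝 ‖a + w + (0 : ℝ) • L a‖) :=
      (Continuous.tendsto (by fun_prop) 0).mono_left nhdsWithin_le_nhds
    have := ge_of_tendsto h (eventually_mem_nhdsWithin.mono fun t ht ↦ scaled a t ht)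
    simpa using this
  have : w = 0 := by simpa using key (-w)
  exact sub_eq_zero.mp this

section CStarAlgebra

variable {A : Type*} [CStarAlgebra A]

/-- If the norm of a self-adjoint element `x` belongs to its spectrum, then `‖x‖ - x` has a square
root which is almost annihilated by self-adjoint elements of norm one. -/
theorem IsSelfAdjoint.exists_sqrt_norm_sub_of_norm_mem_spectrum {x : A} (hx : IsSelfAdjoint x)
    (hs : ‖x‖ ∈ spectrum ℝ x) :
    ∃ k : A, k * k = algebraMap ℝ A ‖x‖ - x ∧
      ∀ δ > 0, ∃ a : A, IsSelfAdjoint a ∧ ‖a‖ = 1 ∧ ‖k * a‖ ≤ δ ∧ ‖a * k‖ ≤ δ := by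
  have hspec (s : ℝ) (h : s ∈ spectrum ℝ x) : s ≤ ‖x‖ := by
    have : Nontrivial A := ⟨⟨0, 1, fun h0 ↦ by
      have := subsingleton_of_zero_eq_one h0
      simp [spectrum.of_subsingleton] at h⟩⟩
    exact (le_abs_self s).trans (spectrum.norm_le_norm_of_mem h)
  refine ⟨cfc (fun s : ℝ ↦ √(‖x‖ - s)) x, ?_, fun δ hδ ↦ ?_⟩
  · rw [← cfc_mul _ _ x, cfc_congr (g := fun s : ℝ ↦ ‖x‖ - s)
      fun s h ↦ Real.mul_self_sqrt (sub_nonneg.2 (hspec s h)), cfc_sub _ _ x, cfc_const _ x,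
      cfc_id' ℝ x]
  · have hbound (r : ℝ) (hr : 0 ≤ r) : r * max 0 (1 - r / δ) ≤ δ := by
      rcases max_cases 0 (1 - r / δ) with ⟨h, -⟩ | ⟨h, h'⟩ <;> rw [h]
      · simpa using hδ.le
      · have : r < δ := by simpa [div_lt_one hδ] using h'
        nlinarith [div_nonneg hr hδ.le]
    have hnn (r : ℝ) : 0 ≤ max 0 (1 - r / δ) := le_max_left _ _
    refine ⟨cfc (fun s : ℝ ↦ max 0 (1 - √(‖x‖ - s) / δ)) x, cfc_predicate _ _,
      le_antisymm (norm_cfc_le zero_le_one fun s _ ↦ ?_) ?_, ?_, ?_⟩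
    · rw [Real.norm_of_nonneg (hnn _)]
      exact max_le zero_le_one (by linarith [div_nonneg (Real.sqrt_nonneg (‖x‖ - s)) hδ.le])
    · simpa using norm_apply_le_norm_cfc (fun s : ℝ ↦ max 0 (1 - √(‖x‖ - s) / δ)) x hs
    · rw [← cfc_mul _ _ x]
      refine norm_cfc_le hδ.le fun s _ ↦ ?_
      rw [Real.norm_of_nonneg (mul_nonneg (Real.sqrt_nonneg _) (hnn _))]
      exact hbound _ (Real.sqrt_nonneg _)
    · rw [← cfc_mul _ _ x]
      refine norm_cfc_le hδ.le fun s _ ↦ ?_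
      rw [mul_comm, Real.norm_of_nonneg (mul_nonneg (Real.sqrt_nonneg _) (hnn _))]
      exact hbound _ (Real.sqrt_nonneg _)

theorem IsSelfAdjoint.norm_le_norm_add_realPart_of_norm_mem_spectrum (D : A →ₗ[ℂ] A)
    (hD : ∀ x y, D (x * y) = D x * y + x * D y) {x : A} (hx : IsSelfAdjoint x)
    (hs : ‖x‖ ∈ spectrum ℝ x) : ‖x‖ ≤ ‖x + (ℜ (D x) : A)‖ := by
  obtain ⟨k, hk, hka⟩ := hx.exists_sqrt_norm_sub_of_norm_mem_spectrum hs
  have hD1 : D 1 = 0 := by simpa using hD 1 1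
  have hxk : x = ((‖x‖ : ℝ) : ℂ) • 1 - k * k := by
    rw [hk, Algebra.algebraMap_eq_smul_one, Complex.coe_smul]; abel
  have hDx : D x = -(D k * k + k * D k) := by
    conv_lhs => rw [hxk]
    rw [map_sub, map_smul, hD1, hD]; simp
  have key (δ : ℝ) (hδ : 0 < δ) : ‖x‖ ≤ ‖x + (ℜ (D x) : A)‖ + (‖k‖ + 2 * ‖D k‖) * δ := by
    obtain ⟨a, ha, ha1, h1, h2⟩ := hka δ hδ
    have hDa : ‖a * D x * a‖ ≤ 2 * ‖D k‖ * δ := by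
      have : a * D x * a = -(a * D k * (k * a) + a * k * (D k * a)) := by
        rw [hDx]; noncomm_ring
      rw [this, norm_neg]
      have e1 : ‖a * D k * (k * a)‖ ≤ (1 * ‖D k‖) * δ :=
        (norm_mul_le _ _).trans (by gcongr; exact ha1 ▸ norm_mul_le _ _)
      have e2 : ‖a * k * (D k * a)‖ ≤ δ * (‖D k‖ * 1) :=
        (norm_mul_le _ _).trans (by gcongr; exact ha1 ▸ norm_mul_le _ _)
      linarith [norm_add_le (a * D k * (k * a)) (a * k * (D k * a))]
    have hRa : ‖a * (ℜ (D x) : A) * a‖ ≤ 2 * ‖D k‖ * δ := by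
      have : a * (ℜ (D x) : A) * a = (ℜ (a * D x * a) : A) := by
        simp only [realPart_apply_coe, star_mul, ha.star_eq, mul_smul_comm, smul_mul_assoc,
          mul_add, add_mul, mul_assoc]
      rw [this]
      exact (realPart.norm_le _).trans hDa
    have hkk : ‖a * k * (k * a)‖ ≤ δ * (‖k‖ * 1) :=
      (norm_mul_le _ _).trans (by gcongr; exact ha1 ▸ norm_mul_le _ _)
    have hxR : ‖a * (x + (ℜ (D x) : A)) * a‖ ≤ ‖x + (ℜ (D x) : A)‖ := by
      calc _ ≤ ‖a‖ * ‖x + (ℜ (D x) : A)‖ * ‖a‖ :=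
            (norm_mul_le _ _).trans (by gcongr; exact norm_mul_le _ _)
        _ = _ := by simp [ha1]
    have haa : ‖‖x‖ • (a * a)‖ = ‖x‖ := by
      have : ‖a * a‖ = 1 := by
        simpa [ha.star_eq, ha1] using CStarRing.norm_star_mul_self (x := a)
      simp [norm_smul, this]
    have hsum : ‖x‖ • (a * a) = a * (x + (ℜ (D x) : A)) * a + a * k * (k * a)
        - a * (ℜ (D x) : A) * a := by
      have : a * k * (k * a) = a * (k * k) * a := by noncomm_ring
      rw [this, hk, Algebra.algebraMap_eq_smul_one]
      simp only [mul_sub, sub_mul, mul_add, add_mul, mul_smul_comm, smul_mul_assoc, mul_one]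
      abel
    rw [hsum] at haa
    have t1 := norm_sub_le (a * (x + (ℜ (D x) : A)) * a + a * k * (k * a))
      (a * (ℜ (D x) : A) * a)
    have t2 := norm_add_le (a * (x + (ℜ (D x) : A)) * a) (a * k * (k * a))
    linarith
  have hlim : Tendsto (fun δ : ℝ ↦ ‖x + (ℜ (D x) : A)‖ + (‖k‖ + 2 * ‖D k‖) * δ) (𝓝[>] 0)
      (𝓝 (‖x + (ℜ (D x) : A)‖ + (‖k‖ + 2 * ‖D k‖) * 0)) :=
    (Continuous.tendsto (by fun_prop) 0).mono_left nhdsWithin_le_nhds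
  simpa using ge_of_tendsto hlim (eventually_mem_nhdsWithin.mono fun δ hδ ↦ key δ hδ)

/-- The real part of a derivation is dissipative on self-adjoint elements. -/
theorem IsSelfAdjoint.norm_le_norm_add_realPart (D : A →ₗ[ℂ] A)
    (hD : ∀ x y, D (x * y) = D x * y + x * D y) {x : A} (hx : IsSelfAdjoint x) :
    ‖x‖ ≤ ‖x + (ℜ (D x) : A)‖ := by
  nontriviality A
  rcases CStarAlgebra.norm_or_neg_norm_mem_spectrum hx with h | h
  · exact hx.norm_le_norm_add_realPart_of_norm_mem_spectrum D hD h
  · have h' : ‖-x‖ ∈ spectrum ℝ (-x) := by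
      rw [norm_neg, ← spectrum.neg_eq]
      simpa using h
    have := hx.neg.norm_le_norm_add_realPart_of_norm_mem_spectrum D hD h'
    rwa [norm_neg, map_neg, map_neg, NegMemClass.coe_neg, ← neg_add, norm_neg] at this

theorem continuous_realPart_derivation_selfAdjoint (D : A →ₗ[ℂ] A)
    (hD : ∀ x y, D (x * y) = D x * y + x * D y) :
    Continuous fun x : selfAdjoint A ↦ ℜ (D (x : A)) := by
  have : CompleteSpace (selfAdjoint A) :=
    (isClosed_eq continuous_star continuous_id : IsClosed {x : A | star x = x}).completeSpace_coe
  let L : selfAdjoint A →ₗ[ℝ] selfAdjoint A :=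
    realPart ∘ₗ D.restrictScalars ℝ ∘ₗ (selfAdjoint.submodule ℝ A).subtype
  refine L.continuous_of_norm_le_norm_add_smul fun t x ↦ ?_
  have := x.2.norm_le_norm_add_realPart ((t : ℂ) • D) fun y z ↦ by
    simp [hD]
  simp only [LinearMap.smul_apply, Complex.coe_smul, map_smul] at this
  exact this

/-- Every derivation of a unital C⋆-algebra is continuous. -/
theorem CStarAlgebra.continuous_derivation (D : A →ₗ[ℂ] A)
    (hD : ∀ x y, D (x * y) = D x * y + x * D y) : Continuous D := by
  have hre := continuous_realPart_derivation_selfAdjoint D hD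
  have him := continuous_realPart_derivation_selfAdjoint ((-Complex.I) • D) fun y z ↦ by
    simp [hD, add_comm]
  have hsa : Continuous fun x : selfAdjoint A ↦ D (x : A) := by
    refine ((continuous_subtype_val.comp hre).add
      ((continuous_subtype_val.comp him).const_smul Complex.I)).congr fun x ↦ ?_
    have h : ℜ (((-Complex.I) • D) (x : A)) = ℑ (D (x : A)) := by simp
    change (ℜ (D (x : A)) : A) + Complex.I • (ℜ (((-Complex.I) • D) (x : A)) : A) = D x
    rw [h]
    exact realPart_add_I_smul_imaginaryPart _
  have hr : Continuous (ℜ : A → selfAdjoint A) :=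
    AddMonoidHomClass.continuous_of_bound (ℜ : A →ₗ[ℝ] selfAdjoint A) 1 fun x ↦ by
      simpa using realPart.norm_le x
  have hi : Continuous (ℑ : A → selfAdjoint A) :=
    AddMonoidHomClass.continuous_of_bound (ℑ : A →ₗ[ℝ] selfAdjoint A) 1 fun x ↦ by
      simpa using imaginaryPart.norm_le x
  refine ((hsa.comp hr).add ((hsa.comp hi).const_smul Complex.I)).congr fun x ↦ ?_
  change D (ℜ x : A) + Complex.I • D (ℑ x : A) = D x
  rw [← map_smul, ← map_add, realPart_add_I_smul_imaginaryPart]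

/-- Every generalized derivation of a unital C⋆-algebra is continuous. -/
theorem CStarAlgebra.continuous_generalized_derivation (T : A →ₗ[ℂ] A)
    (hT : ∀ x y, T (x * y) = T x * y + x * T y - x * T 1 * y) : Continuous T := by
  have h := CStarAlgebra.continuous_derivation (T - LinearMap.mulLeft ℂ (T 1)) fun x y ↦ by
    simp only [LinearMap.sub_apply, LinearMap.mulLeft_apply, hT]
    noncomm_ring
  exact (h.add (continuous_const_mul (T 1))).congr fun x ↦ by simp

end CStarAlgebra

/-- Every generalized derivation on a von Neumann algebra is continuous. -/
theorem stmt12 {H : Type*} [NormedAddCommGroup H] [InnerProductSpace ℂ H] [CompleteSpace H]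
    (M : VonNeumannAlgebra H)
    (T : M.toStarSubalgebra →ₗ[ℂ] M.toStarSubalgebra)
    (hT : ∀ x y : M.toStarSubalgebra, T (x * y) = T x * y + x * T y - x * T 1 * y) :
    Continuous T := by
  have : IsClosed (M.toStarSubalgebra : Set (H →L[ℂ] H)) := by
    rw [M.coe_toStarSubalgebra, ← M.centralizer_centralizer]
    exact Set.isClosed_centralizer _
  exact CStarAlgebra.continuous_generalized_derivation T hT
end
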